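/- Assume d ≥ 2, let Q ∈ ℂ[t] be a polynomial and let 0 ≤ n ≤ d−1. Then there exist polynomials c_0, …, c_{d−1} ∈ ℂ[s] such that for all s with Re s > 0, the exponential period ∫_0^{+∞·ω_n} t^s Q(t) e^{P_0(t)} dt := e^{2πin(s+1)/d} ∫_0^∞ u^s Q(ω_n u) e^{P_0(ω_n u)} du equals Σ_{k=0}^{d−1} c_k(s) Ω_n(s+k). -/

import Mathlib

/-- The polynomial `P₀(t) = -t^d/d + ∑_{k=1}^{d-1} a_k t^k`. -/
noncomputable def P0 (d : ℕ) (a : ℕ → ℂ) (t : ℂ) : ℂ :=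
  -t ^ d / (d : ℂ) + ∑ k ∈ Finset.Ico 1 d, a k * t ^ k

/-- The Omega function `Ω_k(s) = e^{2πiks/d} ∫_0^∞ u^{s-1} e^{P₀(ω_k u)} du`, for `Re s > 0`,
where `ω_k = e^{2πik/d}` and `u^{s-1} = exp((s-1) log u)` for real `u > 0`. -/
noncomputable def OmegaFn (d : ℕ) (a : ℕ → ℂ) (k : ℕ) (s : ℂ) : ℂ :=
  Complex.exp (2 * Real.pi * Complex.I * k * s / d) *
    ∫ u in Set.Ioi (0 : ℝ),
      (u : ℂ) ^ (s - 1) *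
        Complex.exp (P0 d a (Complex.exp (2 * Real.pi * Complex.I * k / d) * u))

open MeasureTheory Filter Topology in
/-- The dominating bound `‖exp (P₀(w u))‖ ≤ exp (C - u)` along a ray with `w ^ d = 1`. -/
theorem exists_norm_exp_P0_le {d : ℕ} (hd : 2 ≤ d) (a : ℕ → ℂ) {w : ℂ} (hw : w ^ d = 1) :
    ∃ C : ℝ, ∀ u : ℝ, 0 ≤ u →
      ‖Complex.exp (P0 d a (w * u))‖ ≤ Real.exp C * Real.exp (-u) := by
  have hd0 : d ≠ 0 := by omega
  have hdpos : (0 : ℝ) < d := by positivity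
  have hw1 : ‖w‖ = 1 := Complex.norm_eq_one_of_pow_eq_one hw hd0
  set g : ℝ → ℝ := fun u => u + ∑ k ∈ Finset.Ico 1 d, ‖a k‖ * u ^ k with hg
  have hlit : g =o[atTop] fun u : ℝ => u ^ d := by
    have hsum : (fun u : ℝ => ∑ k ∈ Finset.Ico 1 d, ‖a k‖ * u ^ k) =o[atTop] fun u => u ^ d :=
      Asymptotics.IsLittleO.fun_sum fun k hk =>
        (Asymptotics.isLittleO_pow_pow_atTop_of_lt (Finset.mem_Ico.1 hk).2).const_mul_left _
    refine Asymptotics.IsLittleO.add ?_ hsum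
    simpa using Asymptotics.isLittleO_pow_pow_atTop_of_lt (𝕜 := ℝ) (show 1 < d by omega)
  obtain ⟨R, hR⟩ := eventually_atTop.1 (hlit.bound (show (0 : ℝ) < 1 / d by positivity))
  have hgc : Continuous g := by fun_prop
  obtain ⟨B, hB⟩ := (isCompact_Icc (a := (0 : ℝ)) (b := R)).bddAbove_image hgc.continuousOn
  refine ⟨max B 0, fun u hu => ?_⟩
  have hmain : g u - u ^ d / d ≤ max B 0 := by
    have hud : 0 ≤ u ^ d := pow_nonneg hu d
    rcases le_total R u with h | h
    · have h1 := (le_abs_self _).trans (hR u h)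
      rw [Real.norm_of_nonneg hud] at h1
      have : g u - u ^ d / d ≤ 0 := by
        rw [div_eq_inv_mul, ← one_div]; linarith
      exact this.trans (le_max_right _ _)
    · have h1 : g u ≤ B := hB ⟨u, ⟨hu, h⟩, rfl⟩
      have h2 : 0 ≤ u ^ d / d := by positivity
      exact (by linarith : g u - u ^ d / d ≤ B).trans (le_max_left _ _)
  rw [Complex.norm_exp, ← Real.exp_add, Real.exp_le_exp]
  have hre : (P0 d a (w * u)).re ≤ -(u ^ d / d) + ∑ k ∈ Finset.Ico 1 d, ‖a k‖ * u ^ k := by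
    rw [P0, Complex.add_re, Complex.re_sum]
    refine add_le_add (le_of_eq ?_) (Finset.sum_le_sum fun k _ => ?_)
    · rw [mul_pow, hw, one_mul]
      have : -(u : ℂ) ^ d / (d : ℂ) = ((-(u ^ d / d) : ℝ) : ℂ) := by
        push_cast; ring
      rw [this, Complex.ofReal_re]
    · refine (Complex.re_le_norm _).trans (le_of_eq ?_)
      rw [norm_mul, norm_pow, norm_mul, hw1, one_mul, Complex.norm_real, Real.norm_of_nonneg hu]
  have : g u = u + ∑ k ∈ Finset.Ico 1 d, ‖a k‖ * u ^ k := rfl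
  linarith

/-- The polynomial `P₀` is continuous. -/
theorem continuous_P0 (d : ℕ) (a : ℕ → ℂ) : Continuous (P0 d a) := by
  unfold P0
  fun_prop

open MeasureTheory Filter Topology in
/-- Convergence of the integral defining `OmegaFn`. -/
theorem integrableOn_cpow_mul_exp_P0 {d : ℕ} (hd : 2 ≤ d) (a : ℕ → ℂ) {w : ℂ} (hw : w ^ d = 1)
    {s : ℂ} (hs : 0 < s.re) :
    IntegrableOn (fun u : ℝ => (u : ℂ) ^ (s - 1) * Complex.exp (P0 d a (w * u)))
      (Set.Ioi 0) := by
  obtain ⟨C, hC⟩ := exists_norm_exp_P0_le hd a hw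
  have hP := continuous_P0 d a
  refine ((Real.GammaIntegral_convergent hs).const_mul (Real.exp C)).mono' ?_ ?_
  · refine ContinuousOn.aestronglyMeasurable (ContinuousOn.mul ?_ ?_) measurableSet_Ioi
    · intro u hu
      exact (Complex.continuousAt_ofReal_cpow_const _ _ (Or.inr hu.ne')).continuousWithinAt
    · exact Continuous.continuousOn (by fun_prop)
  · refine (ae_restrict_iff' measurableSet_Ioi).2 (Eventually.of_forall fun u hu => ?_)
    have hu' : 0 < u := hu
    rw [norm_mul, Complex.norm_cpow_eq_rpow_re_of_pos hu']
    have := mul_le_mul_of_nonneg_left (hC u hu'.le) (Real.rpow_nonneg hu'.le (s - 1).re)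
    simp only [Complex.sub_re, Complex.one_re] at this ⊢
    linarith

/-- The Euler-type relation `t P₀'(t) = -t^d + ∑ k a_k t^k`. -/
theorem exists_hasDerivAt_P0 {d : ℕ} (hd : d ≠ 0) (a : ℕ → ℂ) (t : ℂ) :
    ∃ D : ℂ, HasDerivAt (P0 d a) D t ∧
      t * D = -t ^ d + ∑ k ∈ Finset.Ico 1 d, k * a k * t ^ k := by
  have hd' : (d : ℂ) ≠ 0 := by exact_mod_cast hd
  refine ⟨_, ((hasDerivAt_pow d t).fun_neg.div_const (d : ℂ)).fun_add
    (HasDerivAt.fun_sum fun k _ => (hasDerivAt_pow k t).const_mul (a k)), ?_⟩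
  rw [mul_add, Finset.mul_sum]
  congr 1
  · obtain ⟨e, rfl⟩ := Nat.exists_eq_succ_of_ne_zero hd
    field_simp
    simp [pow_succ']
  · refine Finset.sum_congr rfl fun k hk => ?_
    obtain ⟨e, rfl⟩ := Nat.exists_eq_succ_of_ne_zero (by grind : k ≠ 0)
    simp only [Nat.succ_eq_add_one, Nat.add_sub_cancel]
    ring

open MeasureTheory Filter Topology in
/-- Integration by parts for the Mellin transform of `exp (P₀(w u))`. -/
theorem integral_cpow_mul_exp_P0_add {d : ℕ} (hd : 2 ≤ d) (a : ℕ → ℂ) {w : ℂ} (hw : w ^ d = 1)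
    {s : ℂ} (hs : 0 < s.re) :
    (∫ u in Set.Ioi (0 : ℝ), (u : ℂ) ^ (s + d - 1) * Complex.exp (P0 d a (w * u))) =
      s * (∫ u in Set.Ioi (0 : ℝ), (u : ℂ) ^ (s - 1) * Complex.exp (P0 d a (w * u))) +
      ∑ k ∈ Finset.Ico 1 d, k * a k * w ^ k *
        ∫ u in Set.Ioi (0 : ℝ), (u : ℂ) ^ (s + k - 1) * Complex.exp (P0 d a (w * u)) := by
  have hd0 : d ≠ 0 := by omega
  have hs0 : s ≠ 0 := by rintro rfl; simp at hs
  have hP := continuous_P0 d a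
  set F : ℂ → ℝ → ℂ := fun z u => (u : ℂ) ^ (z - 1) * Complex.exp (P0 d a (w * u)) with hF
  have hF_int : ∀ k : ℕ, IntegrableOn (F (s + k)) (Set.Ioi 0) := fun k =>
    integrableOn_cpow_mul_exp_P0 hd a hw (by simp; positivity)
  have hF_int0 : IntegrableOn (F s) (Set.Ioi 0) := integrableOn_cpow_mul_exp_P0 hd a hw hs
  have hsum : IntegrableOn (fun u => ∑ k ∈ Finset.Ico 1 d, k * a k * w ^ k * F (s + k) u)
      (Set.Ioi 0) := integrable_finsetSum _ fun k _ => (hF_int k).const_mul _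
  have hadd : IntegrableOn (fun u => s * F s u +
      ∑ k ∈ Finset.Ico 1 d, k * a k * w ^ k * F (s + k) u) (Set.Ioi 0) :=
    (hF_int0.const_mul s).add hsum
  have key : ∫ u in Set.Ioi (0 : ℝ), (s * F s u +
      ∑ k ∈ Finset.Ico 1 d, k * a k * w ^ k * F (s + k) u - F (s + d) u) =
      0 - (((0 : ℝ) : ℂ) ^ s * Complex.exp (P0 d a (w * (0 : ℝ)))) := by
    refine integral_Ioi_of_hasDerivAt_of_tendsto
      (f := fun u : ℝ => (u : ℂ) ^ s * Complex.exp (P0 d a (w * u))) ?_ ?_ ?_ ?_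
    · refine ContinuousAt.continuousWithinAt (ContinuousAt.mul ?_ ?_)
      · exact Complex.continuousAt_ofReal_cpow_const _ _ (Or.inl hs)
      · exact Continuous.continuousAt (by fun_prop)
    · intro u hu
      have hu' : 0 < u := hu
      have huc : (u : ℂ) ≠ 0 := by exact_mod_cast hu'.ne'
      obtain ⟨D, hD, hDe⟩ := exists_hasDerivAt_P0 hd0 a (w * u)
      have hpow : ∀ k : ℕ, (u : ℂ) ^ (s + k - 1) = (u : ℂ) ^ (s - 1) * (u : ℂ) ^ k := by
        intro k
        rw [← Complex.cpow_natCast, ← Complex.cpow_add _ _ huc]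
        congr 1; ring
      have hpow1 : (u : ℂ) ^ s = (u : ℂ) ^ (s - 1) * u := by
        have := hpow 1
        simpa using this
      have h1 : HasDerivAt (fun y : ℝ => (y : ℂ) ^ s) (s * (u : ℂ) ^ (s - 1)) u :=
        hasDerivAt_ofReal_cpow_const hu'.ne' hs0
      have h2 : HasDerivAt (fun y : ℝ => P0 d a (w * y)) (D * w) u := by
        have h3 : HasDerivAt (fun y : ℂ => w * y) w (u : ℂ) := by
          simpa using (hasDerivAt_id (u : ℂ)).const_mul w
        exact (hD.comp (u : ℂ) h3).comp_ofReal
      refine (h1.mul h2.cexp).congr_deriv ?_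
      have hexp : (u : ℂ) ^ s * (Complex.exp (P0 d a (w * u)) * (D * w)) =
          (u : ℂ) ^ (s - 1) * Complex.exp (P0 d a (w * u)) * (w * u * D) := by
        rw [hpow1]; ring
      rw [hexp, hDe]
      simp only [hF, hpow]
      rw [mul_add, Finset.mul_sum, mul_pow, hw]
      have : ∀ k : ℕ, (u : ℂ) ^ (s - 1) * Complex.exp (P0 d a (w * u)) *
          (k * a k * (w * u) ^ k) = k * a k * w ^ k *
          ((u : ℂ) ^ (s - 1) * (u : ℂ) ^ k * Complex.exp (P0 d a (w * u))) := by
        intro k; rw [mul_pow]; ring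
      simp only [this]
      ring
    · exact hadd.sub (hF_int d)
    · obtain ⟨C, hC⟩ := exists_norm_exp_P0_le hd a hw
      have hlim : Tendsto (fun u : ℝ => Real.exp C * (u ^ s.re * Real.exp (-1 * u))) atTop
          (𝓝 0) := by
        simpa using (tendsto_rpow_mul_exp_neg_mul_atTop_nhds_zero s.re 1 one_pos).const_mul
          (Real.exp C)
      refine squeeze_zero_norm' ?_ hlim
      filter_upwards [eventually_gt_atTop 0] with u hu
      rw [norm_mul, Complex.norm_cpow_eq_rpow_re_of_pos hu]
      have := mul_le_mul_of_nonneg_left (hC u hu.le) (Real.rpow_nonneg hu.le s.re)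
      rw [neg_one_mul]
      linarith
  rw [integral_sub hadd (hF_int d),
    integral_add (hF_int0.const_mul s) hsum,
    integral_finsetSum _ fun k _ => (hF_int k).const_mul _] at key
  simp only [integral_const_mul, Complex.ofReal_zero, Complex.zero_cpow hs0, zero_mul,
    sub_zero] at key
  exact (sub_eq_zero.1 key).symm

/-- The phase `e^{2πins/d}` turns integer shifts of `s` into powers of `ω_n`. -/
theorem exp_phase_add_natCast (d n k : ℕ) (s : ℂ) :
    Complex.exp (2 * Real.pi * Complex.I * n * (s + k) / d) =
      Complex.exp (2 * Real.pi * Complex.I * n * s / d) *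
        Complex.exp (2 * Real.pi * Complex.I * n / d) ^ k := by
  rw [← Complex.exp_nat_mul, ← Complex.exp_add]
  congr 1
  ring

/-- `ω_n = e^{2πin/d}` is a `d`-th root of unity. -/
theorem exp_two_pi_mul_I_mul_div_pow {d : ℕ} (hd : d ≠ 0) (n : ℕ) :
    Complex.exp (2 * Real.pi * Complex.I * n / d) ^ d = 1 := by
  have hd' : (d : ℂ) ≠ 0 := by exact_mod_cast hd
  rw [← Complex.exp_nat_mul, mul_div_cancel₀ _ hd', mul_comm]
  exact Complex.exp_nat_mul_two_pi_mul_I n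

/-- The difference equation satisfied by the Omega functions. -/
theorem OmegaFn_add_degree {d : ℕ} (hd : 2 ≤ d) (a : ℕ → ℂ) (n : ℕ) {s : ℂ} (hs : 0 < s.re) :
    OmegaFn d a n (s + d) =
      s * OmegaFn d a n s + ∑ k ∈ Finset.Ico 1 d, k * a k * OmegaFn d a n (s + k) := by
  have hw := exp_two_pi_mul_I_mul_div_pow (show d ≠ 0 by omega) n
  simp only [OmegaFn, exp_phase_add_natCast]
  rw [integral_cpow_mul_exp_P0_add hd a hw hs, hw, mul_one, mul_add, Finset.mul_sum]
  congr 1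
  · ring
  · exact Finset.sum_congr rfl fun k _ => by ring

/-- Every positive integer shift of an Omega function is a combination of the first `d` shifts
with polynomial coefficients. -/
theorem exists_OmegaFn_add_eq_sum {d : ℕ} (hd : 2 ≤ d) (a : ℕ → ℂ) (n m : ℕ) :
    ∃ c : ℕ → Polynomial ℂ, ∀ s : ℂ, 0 < s.re →
      OmegaFn d a n (s + m) = ∑ k ∈ Finset.range d, (c k).eval s * OmegaFn d a n (s + k) := by
  induction m using Nat.strong_induction_on with
  | _ m ih =>
    rcases lt_or_ge m d with h | h
    · refine ⟨fun k => if k = m then 1 else 0, fun s _ => ?_⟩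
      rw [Finset.sum_eq_single m]
      · simp
      · intro k _ hk; simp [hk]
      · intro hm; exact absurd (Finset.mem_range.2 h) hm
    · obtain ⟨e, rfl⟩ := Nat.exists_eq_add_of_le' h
      have ih' : ∀ k : ℕ, ∃ c : ℕ → Polynomial ℂ, k < d → ∀ s : ℂ, 0 < s.re →
          OmegaFn d a n (s + (e + k : ℕ)) =
            ∑ j ∈ Finset.range d, (c j).eval s * OmegaFn d a n (s + j) := by
        intro k
        by_cases hk : k < d
        · obtain ⟨c, hc⟩ := ih (e + k) (by omega)
          exact ⟨c, fun _ => hc⟩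
        · exact ⟨0, fun h => absurd h hk⟩
      choose c hc using ih'
      refine ⟨fun j => (Polynomial.X + Polynomial.C (e : ℂ)) * c 0 j +
        ∑ k ∈ Finset.Ico 1 d, Polynomial.C (k * a k) * c k j, fun s hs => ?_⟩
      have hrec := OmegaFn_add_degree hd a n (s := s + e) (by simp; positivity)
      have h0 := hc 0 (by omega) s hs
      rw [add_zero] at h0
      have hk : ∀ k ∈ Finset.Ico 1 d, k * a k * OmegaFn d a n (s + e + k) =
          ∑ j ∈ Finset.range d, k * a k * ((c k j).eval s * OmegaFn d a n (s + j)) := by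
        intro k hk
        rw [← Finset.mul_sum, ← hc k (Finset.mem_Ico.1 hk).2 s hs]
        push_cast
        rw [add_assoc]
      rw [Finset.sum_congr rfl hk, h0, Finset.sum_comm, Finset.mul_sum,
        ← Finset.sum_add_distrib] at hrec
      push_cast
      rw [← add_assoc, hrec]
      refine Finset.sum_congr rfl fun j _ => ?_
      simp only [Polynomial.eval_add, Polynomial.eval_mul, Polynomial.eval_X, Polynomial.eval_C,
        Polynomial.eval_finsetSum, add_mul, Finset.sum_mul, mul_assoc]

open MeasureTheory in
/-- The exponential period with polynomial weight `Q` as a combination of shifted Omega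
functions. -/
theorem exp_period_eq_sum_OmegaFn {d : ℕ} (hd : 2 ≤ d) (a : ℕ → ℂ) (Q : Polynomial ℂ) (n : ℕ)
    {s : ℂ} (hs : 0 < s.re) :
    Complex.exp (2 * Real.pi * Complex.I * n * (s + 1) / d) *
        ∫ u in Set.Ioi (0 : ℝ),
          (u : ℂ) ^ s * Q.eval (Complex.exp (2 * Real.pi * Complex.I * n / d) * u) *
            Complex.exp (P0 d a (Complex.exp (2 * Real.pi * Complex.I * n / d) * u))
      = ∑ m ∈ Finset.range (Q.natDegree + 1), Q.coeff m * OmegaFn d a n (s + (m + 1 : ℕ)) := by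
  have hw := exp_two_pi_mul_I_mul_div_pow (show d ≠ 0 by omega) n
  have hphase : ∀ m : ℕ, Complex.exp (2 * Real.pi * Complex.I * n * (s + (m + 1 : ℕ)) / d) =
      Complex.exp (2 * Real.pi * Complex.I * n * (s + 1) / d) *
        Complex.exp (2 * Real.pi * Complex.I * n / d) ^ m := by
    intro m
    rw [← exp_phase_add_natCast]
    push_cast
    ring_nf
  simp only [OmegaFn, hphase]
  set w := Complex.exp (2 * Real.pi * Complex.I * n / d)
  have hcongr : ∀ u ∈ Set.Ioi (0 : ℝ), (u : ℂ) ^ s * Q.eval (w * u) *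
      Complex.exp (P0 d a (w * u)) = ∑ m ∈ Finset.range (Q.natDegree + 1),
        Q.coeff m * w ^ m * ((u : ℂ) ^ (s + (m + 1 : ℕ) - 1) * Complex.exp (P0 d a (w * u))) := by
    intro u hu
    have huc : (u : ℂ) ≠ 0 := by
      have hu' : (0 : ℝ) < u := hu
      exact_mod_cast hu'.ne'
    rw [Polynomial.eval_eq_sum_range, Finset.mul_sum, Finset.sum_mul]
    refine Finset.sum_congr rfl fun m _ => ?_
    have : s + (m + 1 : ℕ) - 1 = s + m := by push_cast; ring
    rw [this, Complex.cpow_add _ _ huc, Complex.cpow_natCast, mul_pow]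
    ring
  rw [setIntegral_congr_fun measurableSet_Ioi hcongr, integral_finsetSum _ fun m _ =>
    (integrableOn_cpow_mul_exp_P0 hd a hw (by simp; positivity)).const_mul _, Finset.mul_sum]
  refine Finset.sum_congr rfl fun m _ => ?_
  rw [integral_const_mul]
  ring

/-- For `d ≥ 2`, a polynomial `Q` and `0 ≤ n ≤ d-1`, there are polynomials
`c_0,…,c_{d-1} ∈ ℂ[s]` such that for all `Re s > 0` the exponential period
`∫_0^{+∞·ω_n} t^s Q(t) e^{P₀(t)} dt = e^{2πin(s+1)/d} ∫_0^∞ u^s Q(ω_n u) e^{P₀(ω_n u)} du`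
equals `∑_{k=0}^{d-1} c_k(s) Ω_n(s+k)`. -/
theorem stmt8 (d : ℕ) (hd : 2 ≤ d) (a : ℕ → ℂ) (Q : Polynomial ℂ)
    (n : ℕ) (hn : n ≤ d - 1) :
    ∃ c : ℕ → Polynomial ℂ,
      ∀ s : ℂ, 0 < s.re →
        Complex.exp (2 * Real.pi * Complex.I * n * (s + 1) / d) *
            ∫ u in Set.Ioi (0 : ℝ),
              (u : ℂ) ^ s * Q.eval (Complex.exp (2 * Real.pi * Complex.I * n / d) * u) *
                Complex.exp (P0 d a (Complex.exp (2 * Real.pi * Complex.I * n / d) * u))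
          = ∑ k ∈ Finset.range d, (c k).eval s * OmegaFn d a n (s + k) := by
  choose c hc using fun m => exists_OmegaFn_add_eq_sum hd a n (m + 1)
  refine ⟨fun k => ∑ m ∈ Finset.range (Q.natDegree + 1), Polynomial.C (Q.coeff m) * c m k,
    fun s hs => ?_⟩
  rw [exp_period_eq_sum_OmegaFn hd a Q n hs]
  simp only [hc _ s hs, Finset.mul_sum, Polynomial.eval_finsetSum, Polynomial.eval_mul,
    Polynomial.eval_C, Finset.sum_mul, mul_assoc]
  exact Finset.sum_comm
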